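/- Fix m ≥ 1 and regard the transfer matrix T_m as a real symmetric matrix. Then the sequence n ↦ (M_{m,n} : ℝ)^{1/n} converges as n → ∞, and its limit α_m is the largest eigenvalue of T_m (the maximum of the spectrum of T_m over ℝ). -/

import Mathlib

/-- There exist indices `i, j` with `A (i+1, j) = A (i, j+1) = 1` (anti-diagonal pair). -/
def hasAnti (m n : ℕ) (A : Fin m × Fin n → Bool) : Prop :=
  ∃ i j, ∃ (hi : i + 1 < m) (hj : j + 1 < n),
    A (⟨i + 1, hi⟩, ⟨j, by omega⟩) = true ∧ A (⟨i, by omega⟩, ⟨j + 1, hj⟩) = true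

/-- There exist indices `i, j` with `A (i, j) = A (i+1, j+1) = 1` (main-diagonal pair). -/
def hasMain (m n : ℕ) (A : Fin m × Fin n → Bool) : Prop :=
  ∃ i j, ∃ (hi : i + 1 < m) (hj : j + 1 < n),
    A (⟨i, by omega⟩, ⟨j, by omega⟩) = true ∧ A (⟨i + 1, hi⟩, ⟨j + 1, hj⟩) = true

/-- `M m n`: the number of `m × n` binary matrices with no two 1's diagonally adjacent,
i.e. the number of placements of mutually nonattacking pawns on an `m × n` board. -/
noncomputable def M (m n : ℕ) : ℕ :=
  Nat.card {A : Fin m × Fin n → Bool // ¬ hasAnti m n A ∧ ¬ hasMain m n A}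

/-- Column vectors `v, w : Fin m → Bool` are cross-orthogonal: for every `i` with
`i + 1 < m`, not (`v i` and `w (i+1)`) and not (`v (i+1)` and `w i`). -/
def crossOrth (m : ℕ) (v w : Fin m → Bool) : Prop :=
  ∀ i, ∀ hi : i + 1 < m,
    ¬ (v ⟨i, by omega⟩ = true ∧ w ⟨i + 1, hi⟩ = true) ∧
    ¬ (v ⟨i + 1, hi⟩ = true ∧ w ⟨i, by omega⟩ = true)

open Classical in
/-- The transfer matrix `T m` as a real matrix, indexed by column vectors, with `(v, w)`
entry `1` if `v` and `w` are cross-orthogonal and `0` otherwise. -/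
noncomputable def T (m : ℕ) : Matrix (Fin m → Bool) (Fin m → Bool) ℝ :=
  Matrix.of fun v w => if crossOrth m v w then 1 else 0

namespace Matrix.IsHermitian

variable {ι : Type*} [Fintype ι] [DecidableEq ι] {A : Matrix ι ι ℝ}

/-- The quadratic form of a power of a real symmetric matrix, in eigenvector coordinates. -/
theorem dotProduct_pow_mulVec (hA : A.IsHermitian) (k : ℕ) (y : ι → ℝ) :
    y ⬝ᵥ (A ^ k *ᵥ y) = ∑ i, hA.eigenvalues i ^ k *
      (star (hA.eigenvectorUnitary : Matrix ι ι ℝ) *ᵥ y) i ^ 2 := by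
  have hpow : A ^ k = (hA.eigenvectorUnitary : Matrix ι ι ℝ) *
      diagonal (hA.eigenvalues ^ k) * star (hA.eigenvectorUnitary : Matrix ι ι ℝ) := by
    conv_lhs => rw [hA.spectral_theorem, ← map_pow, Unitary.conjStarAlgAut_apply, diagonal_pow]
    rfl
  have hvec : y ᵥ* (hA.eigenvectorUnitary : Matrix ι ι ℝ) =
      star (hA.eigenvectorUnitary : Matrix ι ι ℝ) *ᵥ y := by
    rw [← mulVec_transpose, star_eq_conjTranspose, conjTranspose_eq_transpose_of_trivial]
  rw [hpow, ← mulVec_mulVec, ← mulVec_mulVec, dotProduct_mulVec, hvec]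
  simp only [dotProduct, mulVec_diagonal, Pi.pow_apply]
  exact Finset.sum_congr rfl fun i _ => by ring

theorem dotProduct_pow_mulVec_le (hA : A.IsHermitian) {k : ℕ} {b : ℝ}
    (hb : ∀ i, hA.eigenvalues i ^ k ≤ b) (y : ι → ℝ) :
    y ⬝ᵥ (A ^ k *ᵥ y) ≤ b * (y ⬝ᵥ y) := by
  have h0 := hA.dotProduct_pow_mulVec 0 y
  simp only [pow_zero, one_mulVec, one_mul] at h0
  rw [hA.dotProduct_pow_mulVec, h0, Finset.mul_sum]
  gcongr with i
  exact hb i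

theorem eigenvectorBasis_dotProduct_self (hA : A.IsHermitian) (j : ι) :
    ⇑(hA.eigenvectorBasis j) ⬝ᵥ ⇑(hA.eigenvectorBasis j) = 1 := by
  have h := real_inner_self_eq_norm_sq (hA.eigenvectorBasis j)
  rw [hA.eigenvectorBasis.orthonormal.1 j, EuclideanSpace.inner_eq_star_dotProduct] at h
  simpa using h

theorem pow_mulVec_eigenvectorBasis (hA : A.IsHermitian) (k : ℕ) (j : ι) :
    A ^ k *ᵥ ⇑(hA.eigenvectorBasis j) =
      (hA.eigenvalues j) ^ k • ⇑(hA.eigenvectorBasis j) := by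
  induction k with
  | zero => simp
  | succ k ih =>
    rw [pow_succ, ← mulVec_mulVec, mulVec_eigenvectorBasis, mulVec_smul, ih, smul_smul, pow_succ']

theorem abs_eigenvalues_pow_le (hA : A.IsHermitian) {k : ℕ} (hnn : ∀ i j, 0 ≤ (A ^ k) i j) (j : ι) :
    |hA.eigenvalues j| ^ k ≤
      (fun i => |hA.eigenvectorBasis j i|) ⬝ᵥ (A ^ k *ᵥ fun i => |hA.eigenvectorBasis j i|) := by
  have h : hA.eigenvalues j ^ k =
      ⇑(hA.eigenvectorBasis j) ⬝ᵥ (A ^ k *ᵥ ⇑(hA.eigenvectorBasis j)) := by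
    rw [pow_mulVec_eigenvectorBasis, dotProduct_smul, eigenvectorBasis_dotProduct_self,
      smul_eq_mul, mul_one]
  rw [← abs_pow, h]
  simp only [dotProduct, mulVec]
  refine (Finset.abs_sum_le_sum_abs _ _).trans (Finset.sum_le_sum fun a _ => ?_)
  rw [abs_mul]
  gcongr
  refine (Finset.abs_sum_le_sum_abs _ _).trans (Finset.sum_le_sum fun b _ => ?_)
  rw [abs_mul, abs_of_nonneg (hnn a b)]

/-- The entry sums of the powers of an entrywise nonnegative symmetric matrix are comparable to
the powers of its greatest eigenvalue. -/
theorem exists_isGreatest_spectrum_pow_bounds [Nonempty ι] (hA : A.IsHermitian)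
    (hnn : ∀ i j, 0 ≤ A i j) :
    ∃ α : ℝ, IsGreatest (spectrum ℝ A) α ∧ 0 ≤ α ∧
      ∀ k : ℕ, α ^ k ≤ 1 ⬝ᵥ (A ^ k *ᵥ 1) ∧ 1 ⬝ᵥ (A ^ k *ᵥ 1) ≤ α ^ k * Fintype.card ι := by
  obtain ⟨j, hj⟩ := Finite.exists_max hA.eigenvalues
  have hnn_pow (k : ℕ) : ∀ i j, 0 ≤ (A ^ k) i j := by
    induction k with
    | zero => intro i j; rw [pow_zero, one_apply]; positivity
    | succ k ih =>
      intro i j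
      rw [pow_succ, mul_apply]
      exact Finset.sum_nonneg fun l _ => mul_nonneg (ih i l) (hnn l j)
  have habs (i : ι) : |hA.eigenvalues i| ≤ hA.eigenvalues j := by
    have h1 := hA.abs_eigenvalues_pow_le (hnn_pow 1) i
    have h2 := hA.dotProduct_pow_mulVec_le (k := 1) (by simpa using hj)
      fun l => |hA.eigenvectorBasis i l|
    have h3 : (fun l => |hA.eigenvectorBasis i l|) ⬝ᵥ (fun l => |hA.eigenvectorBasis i l|) = 1 := by
      rw [← hA.eigenvectorBasis_dotProduct_self i]
      simp [dotProduct]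
    rw [h3, mul_one] at h2
    simpa using h1.trans h2
  have hpos : 0 ≤ hA.eigenvalues j := (abs_nonneg _).trans (habs j)
  refine ⟨hA.eigenvalues j, ?_, hpos, fun k => ⟨?_, ?_⟩⟩
  · rw [hA.spectrum_real_eq_range_eigenvalues]
    exact ⟨⟨j, rfl⟩, by rintro _ ⟨i, rfl⟩; exact hj i⟩
  · have hle (l : ι) : |hA.eigenvectorBasis j l| ≤ 1 := by
      rw [← sq_le_one_iff_abs_le_one, ← hA.eigenvectorBasis_dotProduct_self j, sq]
      exact Finset.single_le_sum (f := fun l => hA.eigenvectorBasis j l * hA.eigenvectorBasis j l)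
        (fun l _ => mul_self_nonneg _) (Finset.mem_univ l)
    have h := hA.abs_eigenvalues_pow_le (hnn_pow k) j
    rw [abs_of_nonneg hpos] at h
    refine h.trans ?_
    simp only [dotProduct, mulVec, Pi.one_apply]
    gcongr with a _ b _
    · exact Finset.sum_nonneg fun b _ => mul_nonneg (hnn_pow k a b) (abs_nonneg _)
    · exact hle a
    · exact hnn_pow k a b
    · exact hle b
  · have h := hA.dotProduct_pow_mulVec_le (k := k) (b := hA.eigenvalues j ^ k)
      (fun i => (le_abs_self _).trans <| by rw [abs_pow]; gcongr; exact habs i) 1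
    simpa using h

end Matrix.IsHermitian

open Matrix in
/-- Weighted walk counting: entry sums of matrix powers are sums over walks. -/
theorem Matrix.sum_walks {ι R : Type*} [Fintype ι] [DecidableEq ι] [CommSemiring R]
    (A : Matrix ι ι R) (k : ℕ) (g : ι → R) :
    ∑ f : Fin (k + 1) → ι, g (f 0) * ∏ i : Fin k, A (f i.castSucc) (f i.succ) =
      g ⬝ᵥ (A ^ k *ᵥ 1) := by
  induction k generalizing g with
  | zero =>
    rw [← (Equiv.funUnique (Fin 1) ι).symm.sum_comp]
    simp [dotProduct]
  | succ k ih =>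
    rw [← (Fin.consEquiv fun _ => ι).sum_comp, Fintype.sum_prod_type, pow_succ', ← mulVec_mulVec]
    refine Finset.sum_congr rfl fun v _ => ?_
    rw [mulVec, ← ih, Finset.mul_sum]
    refine Finset.sum_congr rfl fun f _ => ?_
    rw [Fin.prod_univ_succ]
    simp [Fin.consEquiv]

theorem not_hasAnti_and_not_hasMain_iff (m k : ℕ) (A : Fin m × Fin (k + 1) → Bool) :
    (¬ hasAnti m (k + 1) A ∧ ¬ hasMain m (k + 1) A) ↔
      ∀ j : Fin k, crossOrth m (fun i => A (i, j.castSucc)) (fun i => A (i, j.succ)) := by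
  constructor
  · rintro ⟨h1, h2⟩ j i hi
    exact ⟨fun h => h2 ⟨i, j, hi, by omega, h⟩, fun h => h1 ⟨i, j, hi, by omega, h⟩⟩
  · intro h
    constructor
    · rintro ⟨i, j, hi, hj, h'⟩
      exact (h ⟨j, by omega⟩ i hi).2 h'
    · rintro ⟨i, j, hi, hj, h'⟩
      exact (h ⟨j, by omega⟩ i hi).1 h'

open Matrix in
theorem M_succ_eq_dotProduct_pow_mulVec (m k : ℕ) :
    (M m (k + 1) : ℝ) = 1 ⬝ᵥ (T m ^ k *ᵥ 1) := by
  classical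
  let e : (Fin m × Fin (k + 1) → Bool) ≃ (Fin (k + 1) → Fin m → Bool) :=
    ((Equiv.prodComm _ _).arrowCongr (Equiv.refl _)).trans (Equiv.curry _ _ _)
  have he : M m (k + 1) = Nat.card {f : Fin (k + 1) → Fin m → Bool //
      ∀ j : Fin k, crossOrth m (f j.castSucc) (f j.succ)} :=
    Nat.card_congr <| e.subtypeEquiv fun A => not_hasAnti_and_not_hasMain_iff m k A
  rw [he, ← sum_walks, Nat.card_eq_fintype_card, Fintype.card_subtype]
  simp [T, Fintype.prod_boole]

theorem T_isHermitian (m : ℕ) : (T m).IsHermitian := by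
  have hsymm (v w : Fin m → Bool) : crossOrth m v w ↔ crossOrth m w v := by
    simp only [crossOrth]
    exact forall₂_congr fun i hi => by tauto
  ext v w
  classical
  simp only [T, Matrix.conjTranspose_apply, Matrix.of_apply, star_trivial]
  exact if_congr (hsymm w v) rfl rfl

theorem one_le_M (m n : ℕ) : 1 ≤ M m n := by
  have : Nonempty {A : Fin m × Fin n → Bool // ¬ hasAnti m n A ∧ ¬ hasMain m n A} :=
    ⟨fun _ => false, by simp [hasAnti], by simp [hasMain]⟩
  exact Nat.card_pos

open Filter Topology in
/-- Sequences trapped between two positive multiples of `α ^ n` have `n`-th root tending to `α`. -/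
theorem tendsto_rpow_one_div_of_pow_bounds {a : ℕ → ℝ} {α c C : ℝ} (hα : 0 ≤ α) (hc : 0 < c)
    (hC : 0 < C) (hlow : ∀ᶠ n in atTop, c * α ^ n ≤ a n) (hupp : ∀ᶠ n in atTop, a n ≤ C * α ^ n) :
    Tendsto (fun n : ℕ => a n ^ (1 / (n : ℝ))) atTop (𝓝 α) := by
  have hroot {b : ℝ} (hb : 0 < b) :
      Tendsto (fun n : ℕ => b ^ (1 / (n : ℝ)) * α) atTop (𝓝 α) := by
    have h := (Real.continuousAt_const_rpow hb.ne').tendsto.comp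
      (tendsto_one_div_atTop_nhds_zero_nat (𝕜 := ℝ))
    simpa using h.mul_const α
  have hpow {b : ℝ} (hb : 0 < b) {n : ℕ} (hn : n ≠ 0) :
      (b * α ^ n) ^ (1 / (n : ℝ)) = b ^ (1 / (n : ℝ)) * α := by
    rw [Real.mul_rpow hb.le (pow_nonneg hα n), one_div, Real.pow_rpow_inv_natCast hα hn]
  refine tendsto_of_tendsto_of_tendsto_of_le_of_le' (hroot hc) (hroot hC) ?_ ?_
  · filter_upwards [hlow, eventually_ne_atTop 0] with n h hn
    rw [← hpow hc hn]
    gcongr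
  · filter_upwards [hlow, hupp, eventually_ne_atTop 0] with n h h' hn
    rw [← hpow hC hn]
    exact Real.rpow_le_rpow ((by positivity : 0 ≤ c * α ^ n).trans h) h' (by positivity)

open Filter in
theorem M_root_tendsto_max_eigenvalue (m : ℕ) (hm : 1 ≤ m) :
    ∃ α : ℝ,
      Tendsto (fun n : ℕ => (M m n : ℝ) ^ (1 / (n : ℝ))) atTop (nhds α) ∧
      IsGreatest (spectrum ℝ (T m)) α := by
  obtain ⟨α, hmax, hnn, hbd⟩ := (T_isHermitian m).exists_isGreatest_spectrum_pow_bounds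
    fun v w => by rw [T, Matrix.of_apply]; positivity
  have hα : 0 < α := by
    refine hnn.lt_of_ne ?_
    rintro rfl
    have h := (hbd 1).2
    rw [← M_succ_eq_dotProduct_pow_mulVec, pow_one, zero_mul] at h
    have h1 : (1 : ℝ) ≤ M m (1 + 1) := by exact_mod_cast one_le_M m (1 + 1)
    linarith
  refine ⟨α, tendsto_rpow_one_div_of_pow_bounds (c := α⁻¹)
    (C := α⁻¹ * Fintype.card (Fin m → Bool)) hnn (by positivity) (by positivity) ?_ ?_, hmax⟩
  · filter_upwards [eventually_ne_atTop 0] with n hn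
    obtain ⟨k, rfl⟩ := Nat.exists_eq_succ_of_ne_zero hn
    rw [Nat.succ_eq_add_one, M_succ_eq_dotProduct_pow_mulVec, pow_succ', inv_mul_cancel_left₀ hα.ne']
    exact (hbd k).1
  · filter_upwards [eventually_ne_atTop 0] with n hn
    obtain ⟨k, rfl⟩ := Nat.exists_eq_succ_of_ne_zero hn
    rw [Nat.succ_eq_add_one, M_succ_eq_dotProduct_pow_mulVec, pow_succ', mul_right_comm,
      inv_mul_cancel_left₀ hα.ne']
    exact (hbd k).2
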